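/- Let γ : [0,1] → Z be a continuous path with γ(0) = z_0, let 𝓑 be a basis for the topology of Z, let K ⊆ [0,1] be compact, and let B ⊆ Z be open with γ(K) ⊆ B. Then there exist a chain c in 𝓑 and a tuple t = (t_0, …, t_n) with 0 = t_0 < t_1 < ⋯ < t_n = 1 such that γ ∈ W_{c,t} and γ′(K) ⊆ B for every γ′ ∈ W_{c,t}. -/

import Mathlib

open TopologicalSpace unitInterval

variable {Z : Type} [TopologicalSpace Z]

/-- The set `W_{c,t}` of based paths `γ` with `γ(t_i) ∈ V_i` and `γ([t_{i-1}, t_i]) ⊆ U_i`. -/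
def pathBasisSet (z₀ : Z) (n : ℕ) (U V : Fin n → Set Z) (t : Fin (n + 1) → I) :
    Set {γ : C(I, Z) // γ 0 = z₀} :=
  {γ | ∀ i : Fin n, γ.1 (t i.succ) ∈ V i ∧
    ∀ s : I, t i.castSucc ≤ s → s ≤ t i.succ → γ.1 s ∈ U i}

/-- `(U_1, V_1, …, U_n, V_n)` is a chain in `𝓑`:
`U_1 ⊇ V_1 ⊆ U_2 ⊇ V_2 ⊆ ⋯ ⊆ U_n ⊇ V_n`. -/
def IsChainIn (𝓑 : Set (Set Z)) (n : ℕ) (U V : Fin n → Set Z) : Prop :=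
  (∀ i, U i ∈ 𝓑) ∧ (∀ i, V i ∈ 𝓑) ∧ (∀ i, V i ⊆ U i) ∧
    ∀ i j : Fin n, (j : ℕ) = (i : ℕ) + 1 → V i ⊆ U j

/-- The collection `𝒲` of all the sets `W_{c,t}`. -/
def pathBasis (z₀ : Z) (𝓑 : Set (Set Z)) : Set (Set {γ : C(I, Z) // γ 0 = z₀}) :=
  {W | ∃ (n : ℕ) (U V : Fin n → Set Z) (t : Fin (n + 1) → I),
    IsChainIn 𝓑 n U V ∧ StrictMono t ∧ t 0 = 0 ∧ t (Fin.last n) = 1 ∧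
      W = pathBasisSet z₀ n U V t}

/-- Every open cover of the unit interval admits a strictly increasing subdivision each of whose
closed pieces lies in a member of the cover. -/
theorem exists_strictMono_Icc_subset_open_cover {ι : Type*} {c : ι → Set I}
    (hc : ∀ i, IsOpen (c i)) (hcov : ∀ x, ∃ i, x ∈ c i) :
    ∃ (n : ℕ) (t : Fin (n + 1) → I), StrictMono t ∧ t 0 = 0 ∧ t (Fin.last n) = 1 ∧
      ∀ i : Fin n, ∃ k, Set.Icc (t i.castSucc) (t i.succ) ⊆ c k := by
  obtain ⟨δ, hδ, hball⟩ := lebesgue_number_lemma_of_metric (isCompact_univ (X := I)) hc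
    fun x _ => Set.mem_iUnion.2 (hcov x)
  obtain ⟨m, hm⟩ := exists_nat_one_div_lt hδ
  have hpos : (0 : ℝ) < m + 1 := by positivity
  refine ⟨m + 1, fun i => ⟨(i : ℝ) / (m + 1), by positivity, ?_⟩, ?_, ?_, ?_, fun i => ?_⟩
  · rw [div_le_one hpos]
    exact_mod_cast Nat.lt_succ_iff.1 i.2
  · intro i j hij
    rw [← Subtype.coe_lt_coe]
    exact div_lt_div_of_pos_right (by exact_mod_cast hij) hpos
  · ext
    simp
  · ext
    simp [hpos.ne']
  · obtain ⟨k, hk⟩ := hball _ (Set.mem_univ (⟨(i : ℝ) / (m + 1), by positivity, by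
      rw [div_le_one hpos]; exact_mod_cast i.2.le⟩ : I))
    refine ⟨k, fun s hs => hk ?_⟩
    have h₁ : (i : ℝ) / (m + 1) ≤ s := hs.1
    have h₂ : (s : ℝ) ≤ ((i.succ : ℕ) : ℝ) / (m + 1) := hs.2
    rw [Fin.val_succ, Nat.cast_add_one, add_div] at h₂
    rw [Metric.mem_ball, Subtype.dist_eq, Real.dist_eq, abs_of_nonneg (sub_nonneg.2 h₁)]
    linarith

/-- Given a path `γ` from `z₀`, a compact `K ⊆ [0,1]` and an open `B ⊆ Z`
with `γ(K) ⊆ B`, there is a basic set `W_{c,t}` containing `γ` all of whose members map `K`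
into `B`. -/
theorem exists_pathBasisSet_subset (z₀ : Z) (𝓑 : Set (Set Z))
    (h𝓑 : IsTopologicalBasis 𝓑) (γ : C(I, Z)) (hγ : γ 0 = z₀)
    (K : Set I) (hK : IsCompact K) (B : Set Z) (hB : IsOpen B) (hKB : γ '' K ⊆ B) :
    ∃ (n : ℕ) (U V : Fin n → Set Z) (t : Fin (n + 1) → I),
      IsChainIn 𝓑 n U V ∧ StrictMono t ∧ t 0 = 0 ∧ t (Fin.last n) = 1 ∧
      (⟨γ, hγ⟩ : {γ : C(I, Z) // γ 0 = z₀}) ∈ pathBasisSet z₀ n U V t ∧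
      ∀ γ' ∈ pathBasisSet z₀ n U V t, γ'.1 '' K ⊆ B := by
  have hloc : ∀ s : I, ∃ A ∈ 𝓑, γ s ∈ A ∧ (s ∈ K → A ⊆ B) := fun s => by
    by_cases hs : s ∈ K
    · obtain ⟨A, hA, hsA, hAB⟩ :=
        h𝓑.exists_subset_of_mem_open (hKB (Set.mem_image_of_mem γ hs)) hB
      exact ⟨A, hA, hsA, fun _ => hAB⟩
    · obtain ⟨A, hA, hsA, -⟩ := h𝓑.exists_subset_of_mem_open (Set.mem_univ (γ s)) isOpen_univ
      exact ⟨A, hA, hsA, fun h => absurd h hs⟩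
  choose A hA hsA hAB using hloc
  obtain ⟨n, t, ht, ht₀, ht₁, hcov⟩ := exists_strictMono_Icc_subset_open_cover
    (c := fun s => γ ⁻¹' A s ∩ {x | x ∈ K → s ∈ K})
    (fun s => by
      refine ((h𝓑.isOpen (hA s)).preimage γ.continuous).inter ?_
      by_cases hs : s ∈ K
      · simp [hs]
      · simp only [hs, imp_false]
        exact hK.isClosed.isOpen_compl)
    fun s => ⟨s, hsA s, id⟩
  choose k hk using hcov
  have hV : ∀ i : Fin n, ∃ V ∈ 𝓑, γ (t i.succ) ∈ V ∧
      V ⊆ A (k i) ∩ ⋂ j : Fin n, ⋂ _ : (j : ℕ) = (i : ℕ) + 1, A (k j) := fun i => by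
    refine h𝓑.exists_subset_of_mem_open ⟨?_, ?_⟩ ((h𝓑.isOpen (hA _)).inter
      (isOpen_iInter_of_finite fun j => isOpen_iInter_of_finite fun _ => h𝓑.isOpen (hA _)))
    · exact (hk i ⟨ht.monotone (Fin.castSucc_lt_succ).le, le_rfl⟩).1
    · refine Set.mem_iInter₂.2 fun j hj => ?_
      have hij : i.succ = j.castSucc := Fin.ext (by simp [hj])
      rw [hij]
      exact (hk j ⟨le_rfl, ht.monotone (Fin.castSucc_lt_succ).le⟩).1
  choose V hV𝓑 hγV hVA using hV
  refine ⟨n, fun i => A (k i), V, t, ⟨fun i => hA _, hV𝓑, fun i => (hVA i).trans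
    Set.inter_subset_left, fun i j hij x hx => Set.mem_iInter₂.1 (hVA i hx).2 j hij⟩,
    ht, ht₀, ht₁, fun i => ⟨hγV i, fun s h₁ h₂ => (hk i ⟨h₁, h₂⟩).1⟩, ?_⟩
  rintro γ' hγ' _ ⟨s, hs, rfl⟩
  obtain ⟨i, h₁, h₂⟩ : ∃ i : Fin n, t i.castSucc ≤ s ∧ s ≤ t i.succ := by
    by_contra! h
    have hle : ∀ i, t i ≤ s := fun i => by
      induction i using Fin.induction with
      | zero => exact ht₀ ▸ nonneg'
      | succ i ih => exact (h i ih).le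
    have hn : n ≠ 0 := by
      rintro rfl
      exact zero_ne_one (ht₀.symm.trans ht₁)
    obtain ⟨m, rfl⟩ := Nat.exists_eq_succ_of_ne_zero hn
    have hlt := h (Fin.last m) (hle _)
    rw [Fin.succ_last, ht₁] at hlt
    exact hlt.not_ge le_one'
  exact hAB (k i) ((hk i ⟨h₁, h₂⟩).2 hs) ((hγ' i).2 s h₁ h₂)
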